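/- arXiv:2403.04323 — 4 statements merged into one kernel-verified Lean document; each statement's English description precedes it below -/
import Mathlib

section
/- Let p ≥ 2 and r > 0 be real numbers. Then for all real numbers a and b, |a + b|^p ≤ (1 + r^{1/(p-1)})^{p-1} · (|a|^p + |b|^p / r). -/
/-- Elementary inequality: for real `p ≥ 2`, `r > 0` and all reals `a, b`,
`|a + b|^p ≤ (1 + r^(1/(p-1)))^(p-1) * (|a|^p + |b|^p / r)`, where powers are real powers. -/
theorem abs_add_rpow_le (p r : ℝ) (hp : 2 ≤ p) (hr : 0 < r) (a b : ℝ) :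
    |a + b| ^ p ≤ (1 + r ^ (1 / (p - 1))) ^ (p - 1) * (|a| ^ p + |b| ^ p / r) := by
  have hp1 : p - 1 ≠ 0 := by linarith
  have hs : 0 < r ^ (1 / (p - 1)) := Real.rpow_pos_of_pos hr _
  have hsr : (r ^ (1 / (p - 1))) ^ (p - 1) = r := by
    rw [← Real.rpow_mul hr.le, one_div_mul_cancel hp1, Real.rpow_one]
  generalize r ^ (1 / (p - 1)) = s at hs hsr
  have hT : 0 < 1 + s := by linarith
  have key : ∀ x : ℝ, 0 < x → x ^ p = x ^ (p - 1) * x := fun x hx => by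
    rw [Real.rpow_sub_one hx.ne']
    field_simp
  have hx : (1 + s) * |a| ∈ Set.Ici (0 : ℝ) := Set.mem_Ici.2 (by positivity)
  have hy : (1 + s) * |b| / s ∈ Set.Ici (0 : ℝ) := Set.mem_Ici.2 (by positivity)
  have h1 : 0 ≤ 1 / (1 + s) := by positivity
  have h2 : 0 ≤ s / (1 + s) := by positivity
  have h3 : 1 / (1 + s) + s / (1 + s) = 1 := by field_simp
  have hc := (convexOn_rpow (p := p) (by linarith)).2 hx hy h1 h2 h3
  simp only [smul_eq_mul] at hc
  have e1 : 1 / (1 + s) * ((1 + s) * |a|) + s / (1 + s) * ((1 + s) * |b| / s) = |a| + |b| := by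
    field_simp
  rw [e1, Real.div_rpow (by positivity) hs.le, Real.mul_rpow hT.le (abs_nonneg a),
    Real.mul_rpow hT.le (abs_nonneg b), key s hs, hsr, key _ hT] at hc
  calc |a + b| ^ p ≤ (|a| + |b|) ^ p :=
        Real.rpow_le_rpow (abs_nonneg _) (abs_add_le a b) (by linarith)
    _ ≤ _ := hc
    _ = _ := by field_simp
end

section
/- Let T > 0 and u₀ > 0. Let u, v : [0,T] → ℝ be continuous with v(t) ≥ 0 and u(t) > 0 for all t ∈ [0,T], and let θ : [0,∞) → [0,∞) be a continuous, nondecreasing function with θ(r) > 0 for every r > 0. Define G(r) = ∫₁^r ds/θ(s) for r > 0. If u(t) ≤ u₀ + ∫₀ᵗ v(s) θ(u(s)) ds for all t ∈ [0,T], then G(u(t)) ≤ G(u₀) + ∫₀ᵗ v(s) ds for all t ∈ [0,T]. -/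
open MeasureTheory intervalIntegral Set

lemma prim_hasDerivAt_aux (f : ℝ → ℝ) (T : ℝ) (hf : ContinuousOn f (Icc 0 T)) (t : ℝ)
    (ht : t ∈ Ioo 0 T) : HasDerivAt (fun x => ∫ s in (0 : ℝ)..x, f s) (f t) t := by
  apply intervalIntegral.integral_hasDerivAt_right
  · apply ContinuousOn.intervalIntegrable
    rw [uIcc_of_le ht.1.le]
    exact hf.mono (Icc_subset_Icc le_rfl ht.2.le)
  · exact (hf.mono Ioo_subset_Icc_self).stronglyMeasurableAtFilter isOpen_Ioo t ht
  · exact hf.continuousAt (Icc_mem_nhds ht.1 ht.2)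

lemma prim_continuousOn_aux (f : ℝ → ℝ) (T : ℝ) (hT : 0 < T) (hf : ContinuousOn f (Icc 0 T)) :
    ContinuousOn (fun x => ∫ s in (0 : ℝ)..x, f s) (Icc 0 T) := by
  have h := intervalIntegral.continuousOn_primitive_interval' (μ := volume) (f := f) (a := 0)
    (b₁ := 0) (b₂ := T)
    (by apply ContinuousOn.intervalIntegrable; rwa [uIcc_of_le hT.le]) left_mem_uIcc
  rwa [uIcc_of_le hT.le] at h

/-- Bihari's inequality: if `u(t) ≤ u₀ + ∫₀ᵗ v(s) θ(u(s)) ds` on `[0,T]`, with `θ`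
continuous, nondecreasing and positive on `(0,∞)`, and `G(r) = ∫₁ʳ ds/θ(s)`, then
`G(u(t)) ≤ G(u₀) + ∫₀ᵗ v(s) ds` on `[0,T]`. -/
theorem bihari_inequality (T u₀ : ℝ) (hT : 0 < T) (hu₀ : 0 < u₀)
    (u v θ : ℝ → ℝ)
    (hu : ContinuousOn u (Icc 0 T)) (hv : ContinuousOn v (Icc 0 T))
    (hvpos : ∀ t ∈ Icc (0 : ℝ) T, 0 ≤ v t)
    (hupos : ∀ t ∈ Icc (0 : ℝ) T, 0 < u t)
    (hθc : ContinuousOn θ (Ici 0)) (hθm : MonotoneOn θ (Ici 0))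
    (hθnonneg : ∀ s : ℝ, 0 ≤ s → 0 ≤ θ s) (hθpos : ∀ s : ℝ, 0 < s → 0 < θ s)
    (G : ℝ → ℝ) (hG : ∀ x : ℝ, 0 < x → G x = ∫ s in (1 : ℝ)..x, 1 / θ s)
    (hineq : ∀ t ∈ Icc (0 : ℝ) T, u t ≤ u₀ + ∫ s in (0 : ℝ)..t, v s * θ (u s)) :
    ∀ t ∈ Icc (0 : ℝ) T, G (u t) ≤ G u₀ + ∫ s in (0 : ℝ)..t, v s := by
  have hθi : ContinuousOn (fun s => 1 / θ s) (Ioi 0) :=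
    continuousOn_const.div (hθc.mono Ioi_subset_Ici_self) (fun x hx => (hθpos x hx).ne')
  have hint : ∀ a b : ℝ, 0 < a → 0 < b → IntervalIntegrable (fun s => 1 / θ s) volume a b := by
    intro a b ha hb
    apply ContinuousOn.intervalIntegrable
    refine hθi.mono fun x hx => ?_
    exact lt_of_lt_of_le (lt_min ha hb) hx.1
  have hGd : ∀ x : ℝ, 0 < x → HasDerivAt G (1 / θ x) x := by
    intro x hx
    have h : HasDerivAt (fun x => ∫ s in (1 : ℝ)..x, 1 / θ s) (1 / θ x) x := by
      apply intervalIntegral.integral_hasDerivAt_right (hint 1 x one_pos hx)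
      · exact hθi.stronglyMeasurableAtFilter isOpen_Ioi x hx
      · exact hθi.continuousAt (Ioi_mem_nhds hx)
    refine h.congr_of_eventuallyEq ?_
    filter_upwards [Ioi_mem_nhds hx] with y hy using hG y hy
  have hGm : MonotoneOn G (Ioi 0) := by
    apply monotoneOn_of_deriv_nonneg (convex_Ioi 0)
    · exact fun x hx => (hGd x hx).continuousAt.continuousWithinAt
    · rw [interior_Ioi]
      exact fun x hx => (hGd x hx).differentiableAt.differentiableWithinAt
    · rw [interior_Ioi]
      intro x hx
      rw [(hGd x hx).deriv]
      exact (one_div_pos.2 (hθpos x hx)).le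
  have hf : ContinuousOn (fun s => v s * θ (u s)) (Icc 0 T) :=
    hv.mul (hθc.comp hu fun x hx => (hupos x hx).le)
  set w : ℝ → ℝ := fun t => u₀ + ∫ s in (0 : ℝ)..t, v s * θ (u s) with hw
  have hwpos : ∀ t ∈ Icc (0 : ℝ) T, 0 < w t := fun t ht => (hupos t ht).trans_le (hineq t ht)
  have hwc : ContinuousOn w (Icc 0 T) := continuousOn_const.add (prim_continuousOn_aux _ T hT hf)
  have hwd : ∀ t ∈ Ioo (0 : ℝ) T, HasDerivAt w (v t * θ (u t)) t := fun t ht =>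
    (prim_hasDerivAt_aux _ T hf t ht).const_add u₀
  have hHd : ∀ t ∈ Ioo (0 : ℝ) T, HasDerivAt (fun t => G (w t) - ∫ s in (0 : ℝ)..t, v s)
      (1 / θ (w t) * (v t * θ (u t)) - v t) t := fun t ht =>
    ((hGd (w t) (hwpos t (Ioo_subset_Icc_self ht))).comp t (hwd t ht)).sub
      (prim_hasDerivAt_aux v T hv t ht)
  have hH : AntitoneOn (fun t => G (w t) - ∫ s in (0 : ℝ)..t, v s) (Icc 0 T) := by
    apply antitoneOn_of_deriv_nonpos (convex_Icc 0 T)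
    · refine ContinuousOn.sub (fun t ht => ?_) (prim_continuousOn_aux v T hT hv)
      exact (hGd (w t) (hwpos t ht)).continuousAt.comp_continuousWithinAt (hwc t ht)
    · rw [interior_Icc]
      exact fun x hx => (hHd x hx).differentiableAt.differentiableWithinAt
    · rw [interior_Icc]
      intro t ht
      have ht' := Ioo_subset_Icc_self ht
      rw [(hHd t ht).deriv]
      have h1 : θ (u t) ≤ θ (w t) := hθm (hupos t ht').le (hwpos t ht').le (hineq t ht')
      have h2 := hθpos _ (hwpos t ht')
      have h3 : v t * θ (u t) ≤ v t * θ (w t) := mul_le_mul_of_nonneg_left h1 (hvpos t ht')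
      rw [sub_nonpos, one_div, inv_mul_le_iff₀ h2]
      linarith
  intro t ht
  have h1 := hH (left_mem_Icc.2 hT.le) ht ht.1
  have h2 := hGm (hupos t ht) (hwpos t ht) (hineq t ht)
  have h0 : w 0 = u₀ := by simp [hw]
  simp only [h0, intervalIntegral.integral_same, sub_zero] at h1
  change G (u t) ≤ G (w t) at h2
  linarith
end

section
/- Let C be a strongly continuous cosine family on a real Hilbert space H with associated sine family S. For all x ∈ H and all s, t ∈ ℝ, the element S(t)(S(s)x) belongs to D(A), and 2 · A(S(t)(S(s)x)) = C(t+s)x − C(t−s)x. -/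
open MeasureTheory intervalIntegral

/-- For a strongly continuous cosine family `C` with sine family `S(t)x = ∫₀ᵗ C(u)x du`:
for all `x ∈ H` and `s, t ∈ ℝ`, `S(t)(S(s)x) ∈ D(A)` and
`2 A(S(t)(S(s)x)) = C(t+s)x − C(t−s)x`, where `A y` denotes the second derivative of
`τ ↦ C(τ)y` at `τ = 0`. -/
theorem cosine_family_two_A_S_S
    {H : Type*} [NormedAddCommGroup H] [InnerProductSpace ℝ H] [CompleteSpace H]
    (C : ℝ → H →L[ℝ] H) (hC0 : C 0 = 1)
    (hCcont : ∀ x : H, Continuous fun t => C t x)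
    (hCcos : ∀ s t : ℝ, ∀ x : H, C (t + s) x + C (t - s) x = 2 • C t (C s x))
    (S : ℝ → H → H) (hS : ∀ (t : ℝ) (x : H), S t x = ∫ u in (0 : ℝ)..t, C u x) :
    ∀ (x : H) (s t : ℝ),
      ContDiff ℝ 2 (fun τ => C τ (S t (S s x))) ∧
      2 • iteratedDeriv 2 (fun τ => C τ (S t (S s x))) 0 = C (t + s) x - C (t - s) x := by
  have hSd : ∀ (x : H) (r : ℝ), HasDerivAt (fun r => S r x) (C r x) r := by
    intro x r
    have h : (fun r => S r x) = fun r => ∫ u in (0 : ℝ)..r, C u x := funext fun r => hS r x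
    rw [h]
    exact (hCcont x).integral_hasStrictDerivAt 0 r |>.hasDerivAt
  have hadd : ∀ (x : H) (s r : ℝ),
      C r (S s x) = (1 / 2 : ℝ) • (S (r + s) x - S (r - s) x) := by
    intro x s r
    have hi : ∀ a b : ℝ, IntervalIntegrable (fun u => C u x) volume a b :=
      fun a b => (hCcont x).intervalIntegrable a b
    have h1 : C r (S s x) = ∫ u in (0 : ℝ)..s, C r (C u x) := by
      rw [hS]
      exact ((C r).intervalIntegral_comp_comm (hi 0 s)).symm
    have h2 : ∀ u, C r (C u x) = (1 / 2 : ℝ) • (C (r + u) x + C (r - u) x) := by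
      intro u
      rw [hCcos u r x, ← Nat.cast_smul_eq_nsmul ℝ, smul_smul]
      norm_num
    have k1 : Continuous fun u => C (r + u) x :=
      (hCcont x).comp (continuous_const.add continuous_id)
    have k2 : Continuous fun u => C (r - u) x :=
      (hCcont x).comp (continuous_const.sub continuous_id)
    rw [h1]
    simp_rw [h2]
    rw [intervalIntegral.integral_smul, intervalIntegral.integral_add
      (k1.intervalIntegrable 0 s) (k2.intervalIntegrable 0 s),
      intervalIntegral.integral_comp_add_left (fun u => C u x),
      intervalIntegral.integral_comp_sub_left (fun u => C u x), hS, hS,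
      intervalIntegral.integral_interval_sub_left (hi _ _) (hi _ _), add_comm,
      sub_zero, add_zero, intervalIntegral.integral_add_adjacent_intervals (hi _ _) (hi _ _)]
  have hder : ∀ (x : H) (s r : ℝ), HasDerivAt (fun r => C r (S s x))
      ((1 / 2 : ℝ) • (C (r + s) x - C (r - s) x)) r := by
    intro x s r
    have h : (fun r => C r (S s x)) = fun r => (1 / 2 : ℝ) • (S (r + s) x - S (r - s) x) :=
      funext fun r => hadd x s r
    rw [h]
    exact (((hSd x (r + s)).comp_add_const r s).sub
      ((hSd x (r - s)).comp_sub_const r s)).const_smul (1 / 2 : ℝ)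
  have heven : ∀ (x : H) (r : ℝ), C (-r) x = C r x := by
    intro x r
    have h := hCcos r 0 x
    rw [hC0, zero_add, zero_sub, two_smul] at h
    exact add_left_cancel h
  intro x s t
  have d1 : deriv (fun τ => C τ (S t (S s x))) =
      fun τ => (1 / 2 : ℝ) • (C (τ + t) (S s x) - C (τ - t) (S s x)) :=
    funext fun τ => (hder (S s x) t τ).deriv
  have h2 : ∀ τ, HasDerivAt
      (fun τ => (1 / 2 : ℝ) • (C (τ + t) (S s x) - C (τ - t) (S s x)))
      ((1 / 2 : ℝ) • ((1 / 2 : ℝ) • (C (τ + t + s) x - C (τ + t - s) x) -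
        (1 / 2 : ℝ) • (C (τ - t + s) x - C (τ - t - s) x))) τ := fun τ =>
    (((hder x s (τ + t)).comp_add_const τ t).sub
      ((hder x s (τ - t)).comp_sub_const τ t)).const_smul (1 / 2 : ℝ)
  have d2 := funext fun τ => (h2 τ).deriv
  have hc : ∀ g : ℝ → ℝ, Continuous g → Continuous fun τ => C (g τ) x :=
    fun g hg => (hCcont x).comp hg
  constructor
  · rw [show (2 : WithTop ℕ∞) = 1 + 1 by norm_num, contDiff_succ_iff_deriv]
    refine ⟨fun τ => (hder (S s x) t τ).differentiableAt, by simp, ?_⟩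
    rw [d1, contDiff_one_iff_deriv]
    refine ⟨fun τ => (h2 τ).differentiableAt, ?_⟩
    rw [d2]
    have c1 := hc (fun τ => τ + t + s) (by fun_prop)
    have c2 := hc (fun τ => τ + t - s) (by fun_prop)
    have c3 := hc (fun τ => τ - t + s) (by fun_prop)
    have c4 := hc (fun τ => τ - t - s) (by fun_prop)
    exact (((c1.sub c2).const_smul _).sub ((c3.sub c4).const_smul _)).const_smul _
  · rw [iteratedDeriv_succ, iteratedDeriv_one, d1, (h2 0).deriv]
    have e1 : C (0 - t + s) x = C (t - s) x := by
      rw [← heven x (t - s)]; congr 2; ring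
    have e2 : C (0 - t - s) x = C (t + s) x := by
      rw [← heven x (t + s)]; congr 2; ring
    rw [e1, e2, zero_add]
    module
end

section
/- Let C be a strongly continuous cosine family on a real Hilbert space H. Then the set D(A) = {x ∈ H : t ↦ C(t)x is twice continuously differentiable on ℝ} is dense in H. -/
open MeasureTheory Filter Topology in
open scoped Convolution in
theorem cosine_family_aux
    {H : Type*} [NormedAddCommGroup H] [InnerProductSpace ℝ H] [CompleteSpace H]
    (C : ℝ → H →L[ℝ] H)
    (hCcont : ∀ x : H, Continuous fun t => C t x)
    (hCcos : ∀ s t : ℝ, ∀ x : H, C (t + s) x + C (t - s) x = 2 • C t (C s x))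
    (φ : ContDiffBump (0 : ℝ)) (x : H) (t : ℝ) :
    C t ((φ.normed volume ⋆[ContinuousLinearMap.lsmul ℝ ℝ, volume] fun t => C t x) 0) =
      (φ.normed volume ⋆[ContinuousLinearMap.lsmul ℝ ℝ, volume] fun t => C t x) t := by
  have hint : ∀ f : ℝ → H, Continuous f →
      Integrable (fun s => φ.normed volume s • f s) volume := by
    intro f hf
    refine Continuous.integrable_of_hasCompactSupport (φ.continuous_normed.smul hf) ?_
    exact φ.hasCompactSupport_normed.smul_right
  have hneg : ∫ s, φ.normed volume s • C (t + s) x = ∫ s, φ.normed volume s • C (t - s) x := by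
    rw [← integral_neg_eq_self]
    refine integral_congr_ae (Eventually.of_forall fun s => ?_)
    simp only [φ.normed_neg, sub_eq_add_neg]
  have h1 : Continuous fun s => C (t - s) x := (hCcont x).comp (by fun_prop)
  have h2 : Continuous fun s => C (t + s) x := (hCcont x).comp (by fun_prop)
  have h3 : Continuous fun s => C (0 - s) x := (hCcont x).comp (by fun_prop)
  simp only [convolution_def, ContinuousLinearMap.lsmul_apply]
  rw [← ContinuousLinearMap.integral_comp_comm _ (hint _ h3)]
  have key : ∀ s, C t (φ.normed volume s • C (0 - s) x) =
      (1/2 : ℝ) • (φ.normed volume s • C (t + s) x + φ.normed volume s • C (t - s) x) := by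
    intro s
    have := hCcos (-s) t x
    rw [sub_neg_eq_add, ← sub_eq_add_neg] at this
    rw [map_smul, ← smul_add, add_comm (C (t + s) x), this, zero_sub, smul_comm, two_smul,
      ← two_smul ℝ, smul_smul (1/2 : ℝ)]
    norm_num
  simp only [key]
  rw [integral_smul, integral_add (hint _ h2) (hint _ h1), hneg, ← two_smul ℝ, smul_smul]
  norm_num

/-- For a strongly continuous cosine family `C` on a real Hilbert space `H`, the set
`D(A) = {x ∈ H : t ↦ C(t)x is twice continuously differentiable}` is dense in `H`. -/
theorem cosine_family_domain_dense
    {H : Type*} [NormedAddCommGroup H] [InnerProductSpace ℝ H] [CompleteSpace H]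
    (C : ℝ → H →L[ℝ] H) (hC0 : C 0 = 1)
    (hCcont : ∀ x : H, Continuous fun t => C t x)
    (hCcos : ∀ s t : ℝ, ∀ x : H, C (t + s) x + C (t - s) x = 2 • C t (C s x)) :
    Dense {x : H | ContDiff ℝ 2 fun t => C t x} := by
  intro x
  let φ : ℕ → ContDiffBump (0 : ℝ) := fun n =>
    ⟨1 / ((n : ℝ) + 1) / 2, 1 / ((n : ℝ) + 1), by positivity, half_lt_self (by positivity)⟩
  have hφ : Filter.Tendsto (fun n => (φ n).rOut) Filter.atTop (nhds 0) :=
    tendsto_one_div_add_atTop_nhds_zero_nat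
  have hlim := ContDiffBump.convolution_tendsto_right_of_continuous
    (μ := MeasureTheory.volume) hφ (hCcont x) 0
  simp only [hC0, ContinuousLinearMap.one_apply] at hlim
  refine mem_closure_of_tendsto hlim (Filter.Eventually.of_forall fun n => ?_)
  simp only [Set.mem_setOf_eq]
  simp only [cosine_family_aux C hCcont hCcos]
  exact (φ n).hasCompactSupport_normed.contDiff_convolution_left _
    (φ n).contDiff_normed (hCcont x).locallyIntegrable
end
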